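/- Let σ be the right cyclic shift (12⋯r) in S_r for r > 1 (the Coxeter element T_{1,2}⋯T_{r-1,r}). Then for σ' ∈ S_r the following are equivalent: (a) σ' ≥ τ for all τ < σ in Bruhat order; (b) σ'(r) = 1, or σ'(r) = 2 and σ'(r-1) = 1; (c) σ' ≥ σ or σ' ≥ σ². -/

import Mathlib

namespace SmoothPerm

variable {n : ℕ}

/-- Bruhat order on `S_n`, via the standard counting criterion. -/
def bruhatLE (τ σ : Equiv.Perm (Fin n)) : Prop :=
  ∀ i j : Fin n,
    (Finset.univ.filter (fun x => x ≤ i ∧ σ x ≤ j)).card ≤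
      (Finset.univ.filter (fun x => x ≤ i ∧ τ x ≤ j)).card

/-- Number of inversions (the length ℓ(σ)). -/
def invNum (σ : Equiv.Perm (Fin n)) : ℕ :=
  (Finset.univ.filter (fun p : Fin n × Fin n => p.1 < p.2 ∧ σ p.2 < σ p.1)).card

def isTransposition (τ : Equiv.Perm (Fin n)) : Prop :=
  ∃ i j : Fin n, i < j ∧ τ = Equiv.swap i j

/-- σ is smooth iff ℓ(σ) equals the number of transpositions Bruhat-below σ. -/
def smooth (σ : Equiv.Perm (Fin n)) : Prop :=
  invNum σ = Nat.card {τ : Equiv.Perm (Fin n) // isTransposition τ ∧ bruhatLE τ σ}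

def avoids4231 (σ : Equiv.Perm (Fin n)) : Prop :=
  ¬ ∃ a b c d : Fin n, a < b ∧ b < c ∧ c < d ∧ σ d < σ b ∧ σ b < σ c ∧ σ c < σ a

/-- covexillary = 3412-avoiding. -/
def covexillary (σ : Equiv.Perm (Fin n)) : Prop :=
  ¬ ∃ a b c d : Fin n, a < b ∧ b < c ∧ c < d ∧ σ c < σ d ∧ σ d < σ a ∧ σ a < σ b

def avoids321 (σ : Equiv.Perm (Fin n)) : Prop :=
  ¬ ∃ a b c : Fin n, a < b ∧ b < c ∧ σ c < σ b ∧ σ b < σ a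

/-- The 3-cycle i ↦ j ↦ k ↦ i. -/
def Rc (i j k : Fin n) : Equiv.Perm (Fin n) := Equiv.swap i k * Equiv.swap i j

def Lc (i j k : Fin n) : Equiv.Perm (Fin n) := (Rc i j k)⁻¹

def inC23 (τ : Equiv.Perm (Fin n)) : Prop :=
  isTransposition τ ∨ ∃ i j k : Fin n, i < j ∧ j < k ∧ (τ = Rc i j k ∨ τ = Lc i j k)

/-- The 2-3-table of σ. -/
def Ctab (σ : Equiv.Perm (Fin n)) : Set (Equiv.Perm (Fin n)) :=
  {τ | inC23 τ ∧ bruhatLE τ σ}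

def admissible (A : Set (Equiv.Perm (Fin n))) : Prop :=
  (∀ τ ∈ A, inC23 τ) ∧
  (∀ σ ∈ A, ∀ τ : Equiv.Perm (Fin n), inC23 τ → bruhatLE τ σ → τ ∈ A) ∧
  (∀ i j k l : Fin n, i < j → j < l → i < k → k < l →
    Rc i j l ∈ A → Lc i k l ∈ A → Equiv.swap i l ∈ A) ∧
  (∀ i j k : Fin n, i < j → j < k →
    Equiv.swap i j ∈ A → Equiv.swap j k ∈ A → (Rc i j k ∈ A ∨ Lc i j k ∈ A))

def isWedge (A : Set (Equiv.Perm (Fin n))) (i j : Fin n) : Prop :=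
  i < j ∧ Equiv.swap i j ∈ A ∧
  (∀ i' : Fin n, (i' : ℕ) + 1 = (i : ℕ) → Equiv.swap i' i ∉ A) ∧
  (∀ j' : Fin n, (j : ℕ) + 1 = (j' : ℕ) → Rc i j j' ∉ A)

def derivedSet (A : Set (Equiv.Perm (Fin n))) (i j : Fin n) : Set (Equiv.Perm (Fin n)) :=
  A \ ({Equiv.swap i j} ∪ {τ | ∃ k, j < k ∧ τ = Lc i j k} ∪
       {τ | ∃ k, i < k ∧ k < j ∧ τ = Rc i k j})

def strictTotalOn (S : Set (Equiv.Perm (Fin n)))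
    (r : Equiv.Perm (Fin n) → Equiv.Perm (Fin n) → Prop) : Prop :=
  (∀ x ∈ S, ¬ r x x) ∧
  (∀ x ∈ S, ∀ y ∈ S, ∀ z ∈ S, r x y → r y z → r x z) ∧
  (∀ x ∈ S, ∀ y ∈ S, x ≠ y → r x y ∨ r y x)

def compatibleOrder (A : Set (Equiv.Perm (Fin n)))
    (r : Equiv.Perm (Fin n) → Equiv.Perm (Fin n) → Prop) : Prop :=
  (∀ i j k : Fin n, i < j → j < k → Rc i j k ∈ A → Lc i j k ∉ A →
    r (Equiv.swap i j) (Equiv.swap j k)) ∧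
  (∀ i j k : Fin n, i < j → j < k → Lc i j k ∈ A → Rc i j k ∉ A →
    r (Equiv.swap j k) (Equiv.swap i j)) ∧
  (∀ i j k : Fin n, i < j → j < k → Equiv.swap i k ∈ A →
    ((r (Equiv.swap i j) (Equiv.swap i k) ∧ r (Equiv.swap i k) (Equiv.swap j k)) ∨
     (r (Equiv.swap j k) (Equiv.swap i k) ∧ r (Equiv.swap i k) (Equiv.swap i j))))

def coversIn (S : Set (Equiv.Perm (Fin n)))
    (r : Equiv.Perm (Fin n) → Equiv.Perm (Fin n) → Prop)
    (x y : Equiv.Perm (Fin n)) : Prop :=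
  x ∈ S ∧ y ∈ S ∧ r x y ∧ ∀ z ∈ S, ¬ (r x z ∧ r z y)

/-- m_σ(i) = max σ([i]). -/
def maxS (σ : Equiv.Perm (Fin n)) (i : Fin n) : Fin n :=
  ((Finset.univ.filter (fun x => x ≤ i)).image (fun x => σ x)).max'
    ⟨σ i, Finset.mem_image_of_mem _ (by simp)⟩

/-- The cyclic shift i → i+1 → ⋯ → j → i. -/
def Rseg (i j : Fin n) : Equiv.Perm (Fin n) :=
  ((List.finRange n).filter (fun x => decide (i ≤ x ∧ x ≤ j))).formPerm

def definedByInclusions (σ : Equiv.Perm (Fin n)) : Prop :=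
  ∀ τ : Equiv.Perm (Fin n),
    (∀ x, maxS τ x ≤ maxS σ x) → (∀ x, maxS τ⁻¹ x ≤ maxS σ⁻¹ x) → bruhatLE τ σ

/-- Rank count. -/
def cnt {r : ℕ} (f : Equiv.Perm (Fin r)) (i j : Fin r) : ℕ :=
  (Finset.univ.filter (fun x => x ≤ i ∧ f x ≤ j)).card

theorem card_val_lt {r : ℕ} (m : ℕ) (hm : m ≤ r) :
    (Finset.univ.filter (fun x : Fin r => x.val < m)).card = m := by
  rw [Fin.card_filter_val_lt]
  exact min_eq_right hm

theorem cnt_upper {r : ℕ} (f : Equiv.Perm (Fin r)) (i j : Fin r) (c : ℕ)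
    (h : ∀ x, x ≤ i → c ≤ (f x).val) : cnt f i j ≤ j.val + 1 - c := by
  unfold cnt
  rw [← Nat.card_Ico]
  apply Finset.card_le_card_of_injOn (fun x => (f x).val)
  · intro x hx
    simp only [Finset.coe_filter, Finset.mem_univ, true_and, Set.mem_ofPred_eq] at hx
    have h1 := h x hx.1
    have h2 : (f x).val ≤ j.val := hx.2
    simp only [Finset.coe_Ico, Set.mem_Ico]
    omega
  · intro x _ y _ hxy
    exact f.injective (Fin.ext hxy)

theorem cnt_upper_left {r : ℕ} (f : Equiv.Perm (Fin r)) (i j : Fin r) :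
    cnt f i j ≤ i.val + 1 := by
  rw [← card_val_lt (r := r) (i.val + 1) i.isLt]
  apply Finset.card_le_card
  intro x hx
  simp only [Finset.mem_filter, Finset.mem_univ, true_and, Fin.le_def] at hx ⊢
  omega

theorem cnt_lower {r : ℕ} (f : Equiv.Perm (Fin r)) (i j : Fin r) (m : ℕ) (hm : m ≤ r)
    (h : ∀ x : Fin r, x.val < m → x ≤ i ∧ f x ≤ j) : m ≤ cnt f i j := by
  rw [← card_val_lt (r := r) m hm]
  apply Finset.card_le_card
  intro x hx
  simp only [Finset.mem_filter, Finset.mem_univ, true_and] at hx ⊢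
  exact h x hx

theorem card_val_le {r : ℕ} (f : Equiv.Perm (Fin r)) (j : Fin r) :
    (Finset.univ.filter (fun x => f x ≤ j)).card = j.val + 1 := by
  rw [← card_val_lt (r := r) (j.val + 1) j.isLt]
  apply Finset.card_bij (fun x _ => f x)
  · intro x hx
    simp only [Finset.mem_filter, Finset.mem_univ, true_and, Fin.le_def] at hx ⊢
    omega
  · intro x _ y _ hxy
    exact f.injective hxy
  · intro y hy
    refine ⟨f.symm y, ?_, by simp⟩
    simp only [Finset.mem_filter, Finset.mem_univ, true_and, Fin.le_def,
      Equiv.apply_symm_apply] at hy ⊢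
    omega

theorem cnt_full {r : ℕ} (f : Equiv.Perm (Fin r)) (i j : Fin r) (hi : i.val + 1 = r) :
    cnt f i j = j.val + 1 := by
  rw [← card_val_le f j]
  unfold cnt
  congr 1
  ext x
  simp only [Finset.mem_filter, Finset.mem_univ, true_and, Fin.le_def]
  have := x.isLt
  omega

theorem cnt_near {r : ℕ} (f : Equiv.Perm (Fin r)) (i j l : Fin r) (hi : i.val + 2 = r)
    (hl : l.val + 1 = r) :
    cnt f i j + (if f l ≤ j then 1 else 0) = j.val + 1 := by
  rw [← card_val_le f j]
  have key : Finset.univ.filter (fun x => x ≤ i ∧ f x ≤ j) =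
      (Finset.univ.filter (fun x => f x ≤ j)).erase l := by
    ext x
    simp only [Finset.mem_filter, Finset.mem_univ, true_and, Fin.le_def, Finset.mem_erase,
      ne_eq, Fin.ext_iff]
    have := x.isLt
    omega
  unfold cnt
  rw [key]
  split_ifs with h
  · apply Finset.card_erase_add_one
    simpa using h
  · rw [Finset.erase_eq_of_notMem]
    · simp
    · simpa using h

theorem rot_val {r : ℕ} (hr : 1 < r) (x : Fin r) :
    (finRotate r x).val = if x.val + 1 = r then 0 else x.val + 1 := by
  obtain ⟨m, rfl⟩ : ∃ m, r = m + 1 := ⟨r - 1, by omega⟩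
  rw [finRotate_apply, Fin.val_add_one]
  simp only [Fin.ext_iff, Fin.val_last]
  split_ifs <;> omega

/-- The elements below the rotation used as witnesses. -/
theorem witness {r : ℕ} (hr : 1 < r) (k l : Fin r) (hk : k.val + 1 < r) (hl : l.val + 1 = r) :
    bruhatLE (finRotate r * Equiv.swap k l) (finRotate r) ∧
      finRotate r * Equiv.swap k l ≠ finRotate r := by
  have hkl : k ≠ l := by
    intro h
    rw [h] at hk
    omega
  constructor
  · intro i j
    change cnt _ i j ≤ cnt _ i j
    by_cases hi : i.val + 1 = r
    · rw [cnt_full _ i j hi, cnt_full _ i j hi]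
    · apply Finset.card_le_card
      intro x hx
      simp only [Finset.mem_filter, Finset.mem_univ, true_and] at hx ⊢
      refine ⟨hx.1, ?_⟩
      have hxi : x.val ≤ i.val := hx.1
      have hilt := i.isLt
      have hxl : x ≠ l := by
        intro h
        rw [h] at hxi
        omega
      rw [Equiv.Perm.mul_apply]
      by_cases hxk : x = k
      · rw [hxk, Equiv.swap_apply_left, Fin.le_def, rot_val hr, if_pos hl]
        exact Nat.zero_le _
      · rw [Equiv.swap_apply_of_ne_of_ne hxk hxl]
        exact hx.2
  · intro h
    have h1 := congrArg (fun g => g k) h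
    simp only [Equiv.Perm.mul_apply, Equiv.swap_apply_left] at h1
    exact hkl ((finRotate r).injective h1).symm

theorem eq_rot {r : ℕ} (hr : 1 < r) (τ : Equiv.Perm (Fin r)) (h : bruhatLE τ (finRotate r))
    (l : Fin r) (hl : l.val + 1 = r) (h0 : (τ l).val = 0) : τ = finRotate r := by
  have hle : ∀ x : Fin r, x.val + 1 < r → (τ x).val ≤ x.val + 1 := by
    intro x hx
    let j : Fin r := ⟨x.val + 1, hx⟩
    have h1 : cnt (finRotate r) x j ≤ cnt τ x j := h x j
    have h2 : x.val + 1 ≤ cnt (finRotate r) x j := by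
      apply cnt_lower _ _ _ _ (by omega)
      intro y hy
      rw [Fin.le_def, Fin.le_def, rot_val hr]
      refine ⟨by omega, ?_⟩
      change _ ≤ x.val + 1
      split_ifs <;> omega
    have h3 : Finset.univ.filter (fun y => y ≤ x ∧ τ y ≤ j) =
        Finset.univ.filter (fun y : Fin r => y.val < x.val + 1) := by
      apply Finset.eq_of_subset_of_card_le
      · intro y hy
        simp only [Finset.mem_filter, Finset.mem_univ, true_and, Fin.le_def] at hy ⊢
        omega
      · rw [card_val_lt _ (by omega)]
        exact h2.trans h1
    have h4 : x ∈ Finset.univ.filter (fun y => y ≤ x ∧ τ y ≤ j) := by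
      rw [h3]
      simp
    simp only [Finset.mem_filter, Finset.mem_univ, true_and] at h4
    exact h4.2
  have heq : ∀ n : ℕ, ∀ x : Fin r, x.val = n → x.val + 1 < r → (τ x).val = x.val + 1 := by
    intro n
    induction n using Nat.strong_induction_on with
    | _ n ih =>
      intro x hxn hx
      by_contra hne
      have h1 := hle x hx
      by_cases hz : (τ x).val = 0
      · have : x = l := τ.injective (Fin.ext (hz.trans h0.symm))
        rw [this] at hx
        omega
      · let y : Fin r := ⟨(τ x).val - 1, by omega⟩
        have hyv : y.val = (τ x).val - 1 := rfl
        have h2 := ih y.val (by omega) y rfl (by omega)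
        have : y = x := τ.injective (Fin.ext (by omega))
        rw [this] at hyv
        omega
  ext x
  rw [rot_val hr]
  split_ifs with hx
  · have : x = l := Fin.ext (by omega)
    rw [this, h0]
  · exact heq _ x rfl (by have := x.isLt; omega)

theorem rot_le {r : ℕ} (hr : 1 < r) (f : Equiv.Perm (Fin r)) (l : Fin r) (hl : l.val + 1 = r)
    (h0 : (f l).val = 0) : bruhatLE (finRotate r) f := by
  intro i j
  change cnt _ i j ≤ cnt _ i j
  have hilt := i.isLt
  have hjlt := j.isLt
  by_cases hi : i.val + 1 = r
  · rw [cnt_full _ i j hi, cnt_full _ i j hi]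
  · have h1 : cnt f i j ≤ j.val + 1 - 1 := by
      apply cnt_upper
      intro x hx
      by_contra hc
      have : x = l := f.injective (Fin.ext (by omega))
      rw [Fin.le_def, this] at hx
      omega
    have h2 := cnt_upper_left f i j
    have h3 : min (i.val + 1) j.val ≤ cnt (finRotate r) i j := by
      apply cnt_lower _ _ _ _ (by omega)
      intro x hx
      rw [Fin.le_def, Fin.le_def, rot_val hr]
      split_ifs <;> omega
    omega

theorem upper_two {r : ℕ} (f : Equiv.Perm (Fin r)) (l p : Fin r)
    (hl : l.val + 1 = r) (hp : p.val + 2 = r) (h1 : (f l).val = 1) (h0 : (f p).val = 0)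
    (i j : Fin r) (hi : i.val + 2 < r) : cnt f i j ≤ j.val - 1 := by
  have : cnt f i j ≤ j.val + 1 - 2 := by
    apply cnt_upper
    intro x hx
    rw [Fin.le_def] at hx
    by_contra hc
    by_cases hz : (f x).val = 0
    · have : x = p := f.injective (Fin.ext (by omega))
      rw [this] at hx
      omega
    · have : x = l := f.injective (Fin.ext (by omega))
      rw [this] at hx
      omega
  omega

theorem rot2_val {r : ℕ} (hr : 1 < r) (x : Fin r) :
    ((finRotate r * finRotate r) x).val =
      if x.val + 1 = r then 1 else if x.val + 2 = r then 0 else x.val + 2 := by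
  rw [Equiv.Perm.mul_apply, rot_val hr, rot_val hr]
  split_ifs <;> omega

theorem rot2_le {r : ℕ} (hr : 1 < r) (f : Equiv.Perm (Fin r)) (l p : Fin r)
    (hl : l.val + 1 = r) (hp : p.val + 2 = r) (h1 : (f l).val = 1) (h0 : (f p).val = 0) :
    bruhatLE (finRotate r * finRotate r) f := by
  intro i j
  change cnt _ i j ≤ cnt _ i j
  have hilt := i.isLt
  have hjlt := j.isLt
  by_cases hi : i.val + 1 = r
  · rw [cnt_full _ i j hi, cnt_full _ i j hi]
  by_cases hi2 : i.val + 2 = r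
  · have a := cnt_near f i j l hi2 hl
    have b := cnt_near (finRotate r * finRotate r) i j l hi2 hl
    have c : (finRotate r * finRotate r) l = f l := by
      apply Fin.ext
      rw [rot2_val hr, if_pos hl, h1]
    rw [c] at b
    omega
  · have a := upper_two f l p hl hp h1 h0 i j (by omega)
    have b := cnt_upper_left f i j
    have c : min (i.val + 1) (j.val - 1) ≤ cnt (finRotate r * finRotate r) i j := by
      apply cnt_lower _ _ _ _ (by omega)
      intro x hx
      rw [Fin.le_def, Fin.le_def, rot2_val hr]
      split_ifs <;> omega
    omega

theorem below_le {r : ℕ} (hr : 1 < r) (f τ : Equiv.Perm (Fin r)) (l p : Fin r)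
    (hl : l.val + 1 = r) (hp : p.val + 2 = r) (h1 : (f l).val = 1) (h0 : (f p).val = 0)
    (hτ : bruhatLE τ (finRotate r)) (hne : τ ≠ finRotate r) : bruhatLE τ f := by
  intro i j
  have hle : cnt (finRotate r) i j ≤ cnt τ i j := hτ i j
  change cnt _ i j ≤ cnt _ i j
  have hilt := i.isLt
  have hjlt := j.isLt
  by_cases hi : i.val + 1 = r
  · rw [cnt_full _ i j hi, cnt_full _ i j hi]
  by_cases hi2 : i.val + 2 = r
  · have a := cnt_near f i j l hi2 hl
    have b := cnt_near (finRotate r) i j l hi2 hl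
    have c := cnt_near τ i j l hi2 hl
    have e : (τ l).val ≠ 0 := fun h => hne (eq_rot hr τ hτ l hl h)
    have d := rot_val hr l
    rw [if_pos hl] at d
    simp only [Fin.le_def] at a b c
    rw [h1] at a
    rw [d] at b
    split_ifs at a b c <;> omega
  · have a := upper_two f l p hl hp h1 h0 i j (by omega)
    have b := cnt_upper_left f i j
    have c : min (i.val + 1) j.val ≤ cnt (finRotate r) i j := by
      apply cnt_lower _ _ _ _ (by omega)
      intro x hx
      rw [Fin.le_def, Fin.le_def, rot_val hr]
      split_ifs <;> omega
    omega

theorem bruhatLE_trans' {r : ℕ} {a b c : Equiv.Perm (Fin r)} (h : bruhatLE a b)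
    (h' : bruhatLE b c) : bruhatLE a c := fun i j => (h' i j).trans (h i j)

/-- If all values of `g` on `[0,i]` exceed `j`, the same holds for everything above `g`. -/
theorem no_small {r : ℕ} {g f : Equiv.Perm (Fin r)} (h : bruhatLE g f) (i j : Fin r)
    (hg : ∀ x, x ≤ i → j < g x) (x : Fin r) (hx : x ≤ i) : j < f x := by
  by_contra hc
  have h1 : cnt f i j ≤ cnt g i j := h i j
  have h2 : cnt g i j = 0 := by
    apply Finset.card_eq_zero.2
    apply Finset.filter_eq_empty_iff.2
    rintro y - ⟨hy, hy'⟩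
    exact absurd (hg y hy) (not_lt.2 hy')
  have h3 : 0 < cnt f i j := by
    apply Finset.card_pos.2
    exact ⟨x, by simpa using ⟨hx, not_lt.1 hc⟩⟩
  omega

theorem a_to_b {r : ℕ} (hr : 1 < r) (f : Equiv.Perm (Fin r)) (l p : Fin r)
    (hl : l.val + 1 = r) (hp : p.val + 2 = r)
    (h : ∀ τ : Equiv.Perm (Fin r), bruhatLE τ (finRotate r) → τ ≠ finRotate r →
        bruhatLE τ f) :
    (f l).val = 0 ∨ ((f l).val = 1 ∧ (f p).val = 0) := by
  by_contra hcon
  push Not at hcon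
  obtain ⟨hl0, hcon⟩ := hcon
  let z : Fin r := ⟨0, by omega⟩
  let o : Fin r := ⟨1, hr⟩
  have hzv : z.val = 0 := rfl
  have hov : o.val = 1 := rfl
  obtain ⟨x, hx⟩ := f.surjective z
  have hxlt := x.isLt
  have hxl : x.val ≠ l.val := fun he => hl0 (by rw [← Fin.ext he, hx])
  by_cases hxp : x.val = p.val
  · have hfp : (f p).val = 0 := by rw [← Fin.ext hxp, hx]
    obtain ⟨y, hy⟩ := f.surjective o
    have hylt := y.isLt
    have hyl : y.val ≠ l.val := by
      intro he
      apply hcon _ hfp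
      rw [← Fin.ext he, hy]
    have hxy : x ≠ y := by
      intro he
      rw [he, hy] at hx
      have := congrArg Fin.val hx
      omega
    obtain ⟨w1, w2⟩ := witness hr z l (by omega) hl
    have w3 : cnt f p o ≤ cnt _ p o := h _ w1 w2 p o
    have w4 : 2 ≤ cnt f p o := by
      rw [← Finset.card_pair hxy]
      apply Finset.card_le_card
      intro t ht
      simp only [Finset.mem_insert, Finset.mem_singleton] at ht
      simp only [Finset.mem_filter, Finset.mem_univ, true_and, Fin.le_def]
      rcases ht with rfl | rfl
      · rw [hx]
        omega
      · rw [hy]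
        omega
    have w5 : cnt (finRotate r * Equiv.swap z l) p o ≤ 1 := by
      rw [← Finset.card_singleton z]
      apply Finset.card_le_card
      intro t ht
      replace ht := (Finset.mem_filter.1 ht).2
      rw [Equiv.Perm.mul_apply] at ht
      rw [Finset.mem_singleton]
      by_contra htz
      have htp : t.val ≤ p.val := ht.1
      have htl : t ≠ l := by
        intro he
        rw [he] at htp
        omega
      have ht2 := ht.2
      rw [Equiv.swap_apply_of_ne_of_ne htz htl, Fin.le_def, rot_val hr] at ht2
      have : t.val ≠ z.val := fun he => htz (Fin.ext he)
      split_ifs at ht2 <;> omega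
    omega
  · obtain ⟨w1, w2⟩ := witness hr p l (by omega) hl
    have := no_small (h _ w1 w2) x z (by
      intro t ht
      rw [Fin.le_def] at ht
      have htp : t ≠ p := by
        intro he
        rw [he] at ht
        omega
      have htl : t ≠ l := by
        intro he
        rw [he] at ht
        omega
      rw [Equiv.Perm.mul_apply, Equiv.swap_apply_of_ne_of_ne htp htl, Fin.lt_def, rot_val hr]
      split_ifs <;> omega) x le_rfl
    rw [hx] at this
    exact lt_irrefl _ this

theorem c_to_b {r : ℕ} (hr : 1 < r) (f : Equiv.Perm (Fin r)) (l p : Fin r)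
    (hl : l.val + 1 = r) (hp : p.val + 2 = r)
    (h : bruhatLE (finRotate r) f ∨ bruhatLE (finRotate r * finRotate r) f) :
    (f l).val = 0 ∨ ((f l).val = 1 ∧ (f p).val = 0) := by
  let z : Fin r := ⟨0, by omega⟩
  let o : Fin r := ⟨1, hr⟩
  have hzv : z.val = 0 := rfl
  have hov : o.val = 1 := rfl
  obtain ⟨x, hx⟩ := f.surjective z
  have hxlt := x.isLt
  obtain ⟨y, hy⟩ := f.surjective o
  have hylt := y.isLt
  have hxy : x.val ≠ y.val := by
    intro he
    rw [Fin.ext he, hy] at hx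
    have := congrArg Fin.val hx
    omega
  rcases h with h | h
  · left
    have hxl : x.val = l.val := by
      by_contra hne
      have := no_small h x z (by
        intro t ht
        rw [Fin.le_def] at ht
        rw [Fin.lt_def, rot_val hr]
        split_ifs <;> omega) x le_rfl
      rw [hx] at this
      exact lt_irrefl _ this
    rw [← Fin.ext hxl, hx]
  · have key : ∀ u : Fin r, (f u).val ≤ 1 → r ≤ u.val + 2 := by
      intro u hu
      by_contra hne
      have := no_small h u o (by
        intro t ht
        rw [Fin.le_def] at ht
        rw [Fin.lt_def, rot2_val hr]
        split_ifs <;> omega) u le_rfl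
      rw [Fin.lt_def] at this
      omega
    have kx := key x (by rw [hx]; omega)
    have ky := key y (by rw [hy])
    by_cases hxl : x.val = l.val
    · left
      rw [← Fin.ext hxl, hx]
    · right
      have e1 : y = l := Fin.ext (by omega)
      have e2 : x = p := Fin.ext (by omega)
      rw [← e1, ← e2, hx, hy]
      exact ⟨rfl, rfl⟩

theorem coxeter_element_tfae (r : ℕ) (hr : 1 < r) (σ' : Equiv.Perm (Fin r)) :
    ((∀ τ : Equiv.Perm (Fin r), bruhatLE τ (finRotate r) → τ ≠ finRotate r →
        bruhatLE τ σ') ↔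
      (σ' ⟨r - 1, by omega⟩ = ⟨0, by omega⟩ ∨
        (σ' ⟨r - 1, by omega⟩ = ⟨1, by omega⟩ ∧ σ' ⟨r - 2, by omega⟩ = ⟨0, by omega⟩))) ∧
    ((σ' ⟨r - 1, by omega⟩ = ⟨0, by omega⟩ ∨
        (σ' ⟨r - 1, by omega⟩ = ⟨1, by omega⟩ ∧ σ' ⟨r - 2, by omega⟩ = ⟨0, by omega⟩)) ↔
      (bruhatLE (finRotate r) σ' ∨ bruhatLE (finRotate r * finRotate r) σ')) := by
  have hl : (⟨r - 1, by omega⟩ : Fin r).val + 1 = r := by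
    change r - 1 + 1 = r
    omega
  have hp : (⟨r - 2, by omega⟩ : Fin r).val + 2 = r := by
    change r - 2 + 2 = r
    omega
  simp only [Fin.ext_iff (b := (⟨0, _⟩ : Fin r)), Fin.ext_iff (b := (⟨1, _⟩ : Fin r))]
  refine ⟨⟨a_to_b hr σ' _ _ hl hp, ?_⟩, ⟨?_, c_to_b hr σ' _ _ hl hp⟩⟩
  · rintro (h | ⟨h1, h0⟩) τ hτ hne
    · exact bruhatLE_trans' hτ (rot_le hr σ' _ hl h)
    · exact below_le hr σ' τ _ _ hl hp h1 h0 hτ hne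
  · rintro (h | ⟨h1, h0⟩)
    · exact Or.inl (rot_le hr σ' _ hl h)
    · exact Or.inr (rot2_le hr σ' _ _ hl hp h1 h0)

end SmoothPerm
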